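/- Let A be a C*-algebra and let a, b, c ∈ A with 0 ≤ a ≤ 1, ‖b‖ ≤ 1, ‖c‖ ≤ 1, and a ≤ (b + c)*(b + c). Then for every δ ∈ (0, 1/2), the 2×2 diagonal matrix diag(f_δ(a), 0) is Cuntz subequivalent in M₂(A) to the diagonal matrix diag(f_{δ/4}(b*b), f_{δ/4}(c*c)). -/

import Mathlib

-- Equip `M₂(A)` with the (L∞-operator) norm; its topology coincides with that of the
-- unique C*-norm on `M₂(A)`, so the Cuntz subequivalence relation below is the usual one.
attribute [local instance] Matrix.linftyOpNonUnitalNormedRing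

/-- The cut-off function `f_ε : ℝ → ℝ`: it is `0` on `(-∞, ε/2]`, `1` on `[ε, ∞)`,
and linear on `[ε/2, ε]` (for `ε > 0`). -/
noncomputable def fcut (ε : ℝ) : ℝ → ℝ := fun t => min 1 (max 0 ((t - ε / 2) / (ε / 2)))

variable {A : Type*} [NonUnitalCStarAlgebra A] [PartialOrder A] [StarOrderedRing A]

/-- Cuntz subequivalence `x ≾ y` of elements of `M₂(A)`:
for every `ε > 0` there is `r` with `‖x − r* y r‖ < ε`. -/
def CuntzLE (x y : Matrix (Fin 2) (Fin 2) A) : Prop :=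
  ∀ ε > (0 : ℝ), ∃ r : Matrix (Fin 2) (Fin 2) A, ‖x - star r * y * r‖ < ε

/-- A right multiple of an element of a non-unital algebra, computed in its unitization, lies in
the algebra. -/
theorem Unitization.exists_inr_eq_inr_mul {A : Type*} [NonUnitalCStarAlgebra A] (a : A)
    (t : Unitization ℂ A) : ∃ r : A, (r : Unitization ℂ A) = (a : Unitization ℂ A) * t :=
  ⟨((a : Unitization ℂ A) * t).snd, by ext <;> simp⟩

theorem continuous_fcut (ε : ℝ) : Continuous (fcut ε) := by
  unfold fcut
  fun_prop

theorem fcut_nonneg (ε t : ℝ) : 0 ≤ fcut ε t := by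
  simp [fcut]

theorem fcut_zero {ε : ℝ} (hε : 0 ≤ ε) : fcut ε 0 = 0 := by
  have : (0 - ε / 2) / (ε / 2) ≤ 0 := div_nonpos_of_nonpos_of_nonneg (by linarith) (by linarith)
  rw [fcut, max_eq_left this, min_eq_right zero_le_one]

/-- On `(-∞, 1]`, the identity exceeds `f_ε` by at most `ε / 2`, as soon as `ε ≤ 2`. -/
theorem le_fcut_add {ε t : ℝ} (hε : 0 < ε) (hε2 : ε ≤ 2) (ht : t ≤ 1) :
    t ≤ fcut ε t + ε / 2 := by
  unfold fcut
  rw [← sub_le_iff_le_add]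
  refine le_min (by linarith) ?_
  rcases le_total (t - ε / 2) 0 with h | h
  · exact h.trans (le_max_left _ _)
  · refine le_max_of_le_right ?_
    rw [le_div_iff₀ (by linarith)]
    nlinarith

/-- A small perturbation of `f_δ` is a multiple, by the square of a continuous function,
of `t - δ / 2`. -/
theorem exists_sq_mul_sub_near_fcut {δ ε : ℝ} (hδ : 0 < δ) (hε : 0 < ε) :
    ∃ g : ℝ → ℝ, Continuous g ∧ g 0 = 0 ∧ (∀ t, 0 ≤ g t * (t - δ / 2) * g t) ∧
      ∀ t, |fcut δ t - g t * (t - δ / 2) * g t| ≤ ε := by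
  have hm (t : ℝ) : 0 < max (t - δ / 2) (ε * (δ / 2)) := lt_max_of_lt_right (by positivity)
  have key (t : ℝ) : √(max (fcut δ t - ε) 0 / max (t - δ / 2) (ε * (δ / 2))) * (t - δ / 2) *
      √(max (fcut δ t - ε) 0 / max (t - δ / 2) (ε * (δ / 2))) = max (fcut δ t - ε) 0 := by
    rw [mul_right_comm, Real.mul_self_sqrt (div_nonneg (le_max_right _ _) (hm t).le)]
    rcases le_total (fcut δ t) ε with h | h
    · simp [max_eq_right (sub_nonpos.2 h)]
    · have h2 : ε * (δ / 2) ≤ t - δ / 2 := by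
        have h3 : fcut δ t ≤ max 0 ((t - δ / 2) / (δ / 2)) := min_le_right _ _
        rcases le_max_iff.1 (h.trans h3) with h4 | h4
        · linarith
        · rwa [le_div_iff₀ (by linarith)] at h4
      have h3 := hm t
      rw [max_eq_left h2] at h3 ⊢
      exact div_mul_cancel₀ _ h3.ne'
  refine ⟨fun t => √(max (fcut δ t - ε) 0 / max (t - δ / 2) (ε * (δ / 2))), ?_, ?_, ?_, ?_⟩
  · have := continuous_fcut δ
    fun_prop (disch := exact fun t => (hm t).ne')
  · simp [fcut_zero hδ.le, hε.le]
  · intro t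
    rw [key]
    exact le_max_right _ _
  · intro t
    rw [key, abs_le]
    have := fcut_nonneg δ t
    rcases le_total (fcut δ t - ε) 0 with h | h
    · rw [max_eq_right h]; constructor <;> linarith
    · rw [max_eq_left h]; constructor <;> linarith

section Unital

variable {B : Type*} [CStarAlgebra B] [PartialOrder B] [StarOrderedRing B]

/-- If `0 ≤ u ≤ v`, then `u` is Cuntz subequivalent to `v`. -/
theorem exists_norm_sub_conjugate_le {u v : B} (hu : 0 ≤ u) (huv : u ≤ v) {η : ℝ} (hη : 0 < η) :
    ∃ w : B, ‖u - star w * v * w‖ ≤ η := by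
  set c : B := v + algebraMap ℝ B η with hc
  have hη' : IsStrictlyPositive (algebraMap ℝ B η) := isStrictlyPositive_algebraMap hη
  have hcpos : IsStrictlyPositive c := hη'.nonneg_add (hu.trans huv)
  set s : B := c ^ (-(1 / 2) : ℝ) with hs
  have hsa : star s = s := (IsSelfAdjoint.of_nonneg CFC.rpow_nonneg).star_eq
  have hscs : s * c * s = 1 := CFC.conjugate_rpow_neg_one_half c
  have hq : star (CFC.sqrt u) = CFC.sqrt u :=
    (IsSelfAdjoint.of_nonneg (CFC.sqrt_nonneg u)).star_eq
  have hqq : CFC.sqrt u * CFC.sqrt u = u := CFC.sqrt_mul_sqrt_self u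
  refine ⟨s * CFC.sqrt u, ?_⟩
  set w := s * CFC.sqrt u with hw
  have hcw : star w * c * w = u := by
    calc star w * c * w = CFC.sqrt u * (s * c * s) * CFC.sqrt u := by
          rw [hw, star_mul, hq, hsa]; noncomm_ring
      _ = u := by rw [hscs, mul_one, hqq]
  have herr : u - star w * v * w = η • (star w * w) := by
    conv_lhs => rw [← hcw, hc]
    rw [Algebra.algebraMap_eq_smul_one]
    simp only [mul_add, add_mul, add_sub_cancel_left, mul_smul_comm, smul_mul_assoc, mul_one]
  have hww : ‖star w * w‖ ≤ 1 := by
    have h1 : w * star w = s * u * s := by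
      rw [hw, star_mul, hq, hsa, mul_assoc, ← mul_assoc (CFC.sqrt u), hqq, mul_assoc]
    have h2 : w * star w ≤ 1 := by
      rw [h1, ← hscs]
      have hle : u ≤ c := huv.trans (le_add_of_nonneg_right hη'.nonneg)
      simpa only [hsa] using star_left_conjugate_le_conjugate hle s
    have h3 := (CStarAlgebra.norm_le_one_iff_of_nonneg _ (mul_star_self_nonneg w)).2 h2
    rwa [CStarRing.norm_star_mul_self, ← CStarRing.norm_self_mul_star]
  rw [herr, norm_smul, Real.norm_of_nonneg hη.le]
  nlinarith

/-- If `0 ≤ a ≤ z + δ / 2`, then `f_δ(a)` is Cuntz subequivalent to `z`, with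
implementing elements that are right multiples of some `g(a)` with `g 0 = 0`. -/
theorem exists_norm_cfc_fcut_sub_conjugate_lt {a z : B} (ha : IsSelfAdjoint a) {δ : ℝ}
    (hδ : 0 < δ) (haz : a ≤ z + algebraMap ℝ B (δ / 2)) {ε : ℝ} (hε : 0 < ε) :
    ∃ g : ℝ → ℝ, Continuous g ∧ g 0 = 0 ∧
      ∃ t : B, ‖cfc (fcut δ) a - star (cfc g a * t) * z * (cfc g a * t)‖ < ε := by
  obtain ⟨g, hg, hg0, hpos, hnear⟩ :=
    exists_sq_mul_sub_near_fcut hδ (show 0 < ε / 3 by positivity)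
  have hgsa : star (cfc g a) = cfc g a := (cfc_predicate g a).star_eq
  have hsub : cfc (fun t => t - δ / 2) a = a - algebraMap ℝ B (δ / 2) := by
    rw [cfc_sub _ _ a, cfc_id' ℝ a, cfc_const _ a]
  have hu : cfc (fun t => g t * (t - δ / 2) * g t) a =
      cfc g a * (a - algebraMap ℝ B (δ / 2)) * cfc g a := by
    rw [cfc_mul _ _ a, cfc_mul _ _ a, hsub]
  have hle : cfc (fun t => g t * (t - δ / 2) * g t) a ≤ cfc g a * z * cfc g a := by
    rw [hu]
    simpa only [hgsa] using star_left_conjugate_le_conjugate (sub_le_iff_le_add.2 haz) (cfc g a)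
  obtain ⟨w, hw⟩ := exists_norm_sub_conjugate_le (cfc_nonneg fun t _ => hpos t) hle
    (show 0 < ε / 3 by positivity)
  refine ⟨g, hg, hg0, w, ?_⟩
  have hf := continuous_fcut δ
  have h1 : ‖cfc (fcut δ) a - cfc (fun t => g t * (t - δ / 2) * g t) a‖ ≤ ε / 3 := by
    rw [← cfc_sub _ _ a]
    exact norm_cfc_le (by positivity) fun t _ => hnear t
  have h2 : star (cfc g a * w) * z * (cfc g a * w) = star w * (cfc g a * z * cfc g a) * w := by
    rw [star_mul, hgsa]; noncomm_ring
  rw [h2]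
  calc _ ≤ _ := norm_sub_le_norm_sub_add_norm_sub _
        (cfc (fun t => g t * (t - δ / 2) * g t) a) _
    _ ≤ ε / 3 + ε / 3 := add_le_add h1 hw
    _ < ε := by linarith

/-- A self-adjoint contraction `x` satisfies `x ≤ f_ε(x) + ε / 2`. -/
theorem le_cfc_fcut_add {x : B} (hx : IsSelfAdjoint x) (hx1 : ‖x‖ ≤ 1) {ε : ℝ} (hε : 0 < ε)
    (hε2 : ε ≤ 2) : x ≤ cfc (fcut ε) x + algebraMap ℝ B (ε / 2) := by
  have hf := continuous_fcut ε
  nontriviality B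
  have h : cfc (fun t => t) x ≤ cfc (fun t => fcut ε t + ε / 2) x :=
    cfc_mono fun t ht => le_fcut_add hε hε2 <|
      (le_abs_self t).trans ((spectrum.norm_le_norm_of_mem ht).trans hx1)
  rwa [cfc_id' ℝ x, cfc_add x (fcut ε) fun _ => ε / 2, cfc_const _ x] at h

end Unital

/-- The square of a sum is at most twice the sum of the squares. -/
theorem star_add_mul_add_le {R : Type*} [NonUnitalRing R] [StarRing R] [PartialOrder R]
    [StarOrderedRing R] (b c : R) :
    star (b + c) * (b + c) ≤ 2 • (star b * b + star c * c) := by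
  rw [← sub_nonneg]
  have : 2 • (star b * b + star c * c) - star (b + c) * (b + c) = star (b - c) * (b - c) := by
    simp only [star_add, star_sub]; noncomm_ring
  rw [this]
  exact star_mul_self_nonneg _

/-- Subequivalence of `diag(x, 0)` and `diag(y₁, y₂)` follows from approximations of `x` by
`r* (y₁ + y₂) r`. -/
theorem cuntzLE_diagonal_of_forall_exists {A : Type*} [NonUnitalCStarAlgebra A] {x y₁ y₂ : A}
    (h : ∀ ε > (0 : ℝ), ∃ r : A, ‖x - star r * (y₁ + y₂) * r‖ < ε) :
    CuntzLE (Matrix.diagonal ![x, 0]) (Matrix.diagonal ![y₁, y₂]) := by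
  intro ε hε
  obtain ⟨r, hr⟩ := h ε hε
  refine ⟨!![r, 0; r, 0], ?_⟩
  have key : Matrix.diagonal ![x, 0] -
      star !![r, 0; r, 0] * Matrix.diagonal ![y₁, y₂] * !![r, 0; r, 0] =
      Matrix.diagonal ![x - star r * (y₁ + y₂) * r, 0] := by
    ext i j
    fin_cases i <;> fin_cases j <;>
      simp [Matrix.mul_apply, Matrix.star_eq_conjTranspose, Matrix.diagonal, mul_add, add_mul]
  rw [key, Matrix.linfty_opNorm_diagonal, pi_norm_lt_iff hε]
  intro i
  fin_cases i <;> simpa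

/-- Lemma 7.1 of the paper (first part).  If `0 ≤ a ≤ 1`, `‖b‖ ≤ 1`,
`‖c‖ ≤ 1` and `a ≤ (b + c)*(b + c)`, then for every `δ ∈ (0, 1/2)`,
`diag(f_δ(a), 0) ≾ diag(f_{δ/4}(b*b), f_{δ/4}(c*c))` in `M₂(A)`. -/
theorem stmt7 (a b c : A) (ha0 : 0 ≤ a) (ha1 : ‖a‖ ≤ 1) (hb : ‖b‖ ≤ 1) (hc : ‖c‖ ≤ 1)
    (h : a ≤ star (b + c) * (b + c)) :
    ∀ δ : ℝ, 0 < δ → δ < 1 / 2 →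
      CuntzLE (Matrix.diagonal ![cfcₙ (fcut δ) a, 0])
        (Matrix.diagonal
          ![cfcₙ (fcut (δ / 4)) (star b * b), cfcₙ (fcut (δ / 4)) (star c * c)]) := by
  intro δ hδ hδ2
  have hf0 : fcut δ 0 = 0 := fcut_zero hδ.le
  have hf0' : fcut (δ / 4) 0 = 0 := fcut_zero (by positivity)
  refine cuntzLE_diagonal_of_forall_exists fun ε hε => ?_
  set X := cfcₙ (fcut (δ / 4)) (star b * b) with hX
  set Y := cfcₙ (fcut (δ / 4)) (star c * c) with hY
  have hasa : IsSelfAdjoint (a : Unitization ℂ A) := .of_nonneg (Unitization.inr_nonneg_iff.2 ha0)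
  have cut (d : A) (hd : ‖d‖ ≤ 1) : ((star d * d : A) : Unitization ℂ A) ≤
      (cfcₙ (fcut (δ / 4)) (star d * d) : A) + algebraMap ℝ (Unitization ℂ A) (δ / 4 / 2) := by
    rw [Unitization.real_cfcₙ_eq_cfc_inr _ _ hf0']
    refine le_cfc_fcut_add ?_ ?_ (by positivity) (by linarith)
    · exact .of_nonneg (Unitization.inr_nonneg_iff.2 (star_mul_self_nonneg d))
    · rw [Unitization.norm_inr, CStarRing.norm_star_mul_self]
      nlinarith [norm_nonneg d]
  have hle : (a : Unitization ℂ A) ≤ 2 • ((X : Unitization ℂ A) + (Y : Unitization ℂ A)) +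
      algebraMap ℝ (Unitization ℂ A) (δ / 2) := by
    have h1 : (a : Unitization ℂ A) ≤ ((2 • (star b * b + star c * c) : A) : Unitization ℂ A) :=
      (Unitization.inr_le_iff _ _ (.of_nonneg ha0) (.of_nonneg (nsmul_nonneg
        (add_nonneg (star_mul_self_nonneg b) (star_mul_self_nonneg c)) 2))).2
        (h.trans (star_add_mul_add_le b c))
    calc (a : Unitization ℂ A) ≤
          2 • (((star b * b : A) : Unitization ℂ A) + ((star c * c : A) : Unitization ℂ A)) := by
          simpa only [Unitization.inr_smul, Unitization.inr_add] using h1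
      _ ≤ 2 • (((X : Unitization ℂ A) + algebraMap ℝ (Unitization ℂ A) (δ / 4 / 2)) +
            ((Y : Unitization ℂ A) + algebraMap ℝ (Unitization ℂ A) (δ / 4 / 2))) :=
          nsmul_le_nsmul_right (add_le_add (cut b hb) (cut c hc)) 2
      _ = _ := by
          rw [show δ / 2 = δ / 4 / 2 + δ / 4 / 2 + δ / 4 / 2 + δ / 4 / 2 by ring]
          simp only [map_add]
          abel
  obtain ⟨g, hg, hg0, t, ht⟩ := exists_norm_cfc_fcut_sub_conjugate_lt hasa hδ hle hε
  rw [← Unitization.real_cfcₙ_eq_cfc_inr _ _ hg0, ← Unitization.real_cfcₙ_eq_cfc_inr _ _ hf0] at ht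
  obtain ⟨r, hr⟩ := Unitization.exists_inr_eq_inr_mul (cfcₙ g a) t
  rw [← hr] at ht
  refine ⟨√2 • r, ?_⟩
  have h2 : star (√2 • r) * (X + Y) * (√2 • r) = star r * (2 • (X + Y)) * r := by
    rw [star_smul, star_trivial, smul_mul_assoc, smul_mul_assoc, mul_smul_comm, smul_smul,
      Real.mul_self_sqrt (by norm_num), mul_smul_comm, smul_mul_assoc, ofNat_smul_eq_nsmul]
  rw [h2, ← Unitization.norm_inr (𝕜 := ℂ)]
  simpa only [Unitization.inr_sub, Unitization.inr_mul, Unitization.inr_star,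
    Unitization.inr_smul, Unitization.inr_add] using ht
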